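/- arXiv:2210.13303 — 6 statements merged into one kernel-verified Lean document; each statement's English description precedes it below -/
import Mathlib

section
/- Let w1 and w2 be cyclically reduced words such that w1 ∉ Mon, w2 ∉ Mon, and the products w1·w2 and w2·w1 have no cancellations. Assume that neither w1 nor w2 contains a maximal occurrence of Λ'-measure > μ. Then every word of the form w1^{α1} w2^{β1} w1^{α2} w2^{β2} ⋯ with all exponents αi, βi ≥ 0 contains no maximal occurrence of Λ'-measure > 2μ. -/
/-- A *word*: a list of letters, where a letter is a free generator of the free group `F`
together with a sign (`true` for the generator, `false` for its inverse). -/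
abbrev Word (α : Type*) := List (α × Bool)

/-- A word is *reduced* if no two adjacent letters cancel. -/
def Reduced {α : Type*} (w : Word α) : Prop :=
  w.Chain' fun a b => ¬(a.1 = b.1 ∧ a.2 = !b.2)

/-- A word is *cyclically reduced* if it is reduced and its last letter is not the inverse of
its first letter; equivalently, `w ++ w` is reduced. -/
def CyclicallyReduced {α : Type*} (w : Word α) : Prop := Reduced (w ++ w)

/-- A set of words is closed under taking subwords. -/
def SubwordClosed {α : Type*} (M : Set (Word α)) : Prop :=
  ∀ w ∈ M, ∀ u : Word α, u <:+: w → u ∈ M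

/-- `Occurs u A i` : the word `u` occurs in the word `A` starting at position `i`.
An *occurrence* of `u` in `A` is such a pair `(i, u)`. -/
def Occurs {α : Type*} (u A : Word α) (i : ℕ) : Prop :=
  ∃ L R : Word α, A = L ++ u ++ R ∧ L.length = i

/-- The occurrence of `u` at position `i` is contained in the occurrence of `v` at position `j`. -/
def OccContained {α : Type*} (i : ℕ) (u : Word α) (j : ℕ) (v : Word α) : Prop :=
  j ≤ i ∧ i + u.length ≤ j + v.length

/-- `IsMaxOcc M A i u` : `(i, u)` is a *maximal occurrence* in `A` with respect to `M`:
an occurrence of an element of `M` in `A` that is not properly contained in any other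
occurrence of an element of `M` in `A`. -/
def IsMaxOcc {α : Type*} (M : Set (Word α)) (A : Word α) (i : ℕ) (u : Word α) : Prop :=
  u ∈ M ∧ Occurs u A i ∧
    ∀ j v, v ∈ M → Occurs v A j → OccContained i u j v → i = j ∧ u = v

/-- `LambdaLe S' u m` says that the `Λ'`-measure of `u` with respect to the set of small
pieces `S'` is at most `m`: `u` is a concatenation of at most `m` elements of `S'`.
Thus `¬ LambdaLe S' u m` says `Λ'(u) > m` (including the case `Λ'(u) = ∞`). -/
def LambdaLe {α : Type*} (S' : Set (Word α)) (u : Word α) (m : ℕ) : Prop :=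
  ∃ parts : List (Word α), (∀ p ∈ parts, p ∈ S') ∧ parts.flatten = u ∧ parts.length ≤ m

theorem LambdaLe.of_infix {α : Type*} {S' : Set (Word α)} (hS' : SubwordClosed S')
    {u v : Word α} {m : ℕ} (h : LambdaLe S' v m) (huv : u <:+: v) : LambdaLe S' u m := by
  obtain ⟨parts, hp, rfl, hm⟩ := h
  induction parts generalizing u m with
  | nil => exact ⟨[], by simp, by simpa using huv, by simp⟩
  | cons p ps ih =>
    simp only [List.mem_cons, forall_eq_or_imp, List.length_cons] at hp hm
    obtain ⟨m, rfl⟩ : ∃ k, m = k + 1 := ⟨m - 1, by omega⟩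
    rw [List.flatten_cons] at huv
    rcases List.infix_append_iff.1 huv with h | h | ⟨s, t, rfl, hs, ht⟩
    · exact ⟨[u], by simpa using hS' p hp.1 u h, by simp, by simp⟩
    · obtain ⟨qs, hq, hu, hl⟩ := ih (m := m) hp.2 (by omega) h
      exact ⟨qs, hq, hu, by omega⟩
    · obtain ⟨qs, hq, hu, hl⟩ := ih (m := m) hp.2 (by omega) ht.isInfix
      refine ⟨s :: qs, ?_, by simp [hu], by simpa using hl⟩
      simpa using ⟨hS' p hp.1 s hs.isInfix, hq⟩

theorem LambdaLe.mono {α : Type*} {S' : Set (Word α)} {u : Word α} {m n : ℕ}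
    (h : LambdaLe S' u m) (hmn : m ≤ n) : LambdaLe S' u n :=
  let ⟨ps, hp, hu, hl⟩ := h
  ⟨ps, hp, hu, hl.trans hmn⟩

theorem LambdaLe.append {α : Type*} {S' : Set (Word α)} {u v : Word α} {m n : ℕ}
    (hu : LambdaLe S' u m) (hv : LambdaLe S' v n) : LambdaLe S' (u ++ v) (m + n) := by
  obtain ⟨ps, hp, rfl, hl⟩ := hu
  obtain ⟨qs, hq, rfl, hl'⟩ := hv
  refine ⟨ps ++ qs, fun p h => ?_, by simp, by simpa using add_le_add hl hl'⟩
  exact (List.mem_append.1 h).elim (hp p) (hq p)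

theorem Occurs.eq_take_drop {α : Type*} {u A : Word α} {i : ℕ} (h : Occurs u A i) :
    u = (A.drop i).take u.length := by
  obtain ⟨L, R, rfl, rfl⟩ := h
  simp

theorem Occurs.length_le {α : Type*} {u A : Word α} {i : ℕ} (h : Occurs u A i) :
    u.length ≤ A.length := by
  obtain ⟨L, R, rfl, rfl⟩ := h
  simp only [List.length_append]
  omega

theorem OccContained.isInfix {α : Type*} {u v A : Word α} {i j : ℕ} (hu : Occurs u A i)
    (hv : Occurs v A j) (h : OccContained i u j v) : u <:+: v := by
  obtain ⟨k, rfl⟩ := Nat.exists_eq_add_of_le h.1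
  have hle : k + u.length ≤ v.length := by have := h.2; omega
  have key : u = (v.drop k).take u.length := by
    rw [hv.eq_take_drop, List.drop_take, List.take_take, List.drop_drop,
      min_eq_left (by omega)]
    exact hu.eq_take_drop
  rw [key]
  exact (List.take_prefix _ _).isInfix.trans (List.drop_suffix _ _).isInfix

theorem LambdaLe.of_forall_isMaxOcc {α : Type*} {M S' : Set (Word α)} (hS' : SubwordClosed S')
    {A : Word α} {m : ℕ} (hA : ∀ i u, IsMaxOcc M A i u → LambdaLe S' u m)
    {u : Word α} (hu : u ∈ M) (huA : u <:+: A) : LambdaLe S' u m := by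
  obtain ⟨L, R, hLR⟩ := huA
  have hocc : Occurs u A L.length := ⟨L, R, hLR.symm, rfl⟩
  by_cases hmax : IsMaxOcc M A L.length u
  · exact hA _ _ hmax
  · simp only [IsMaxOcc, hu, hocc, true_and] at hmax
    push Not at hmax
    obtain ⟨j, v, hv, hvA, hc, hne⟩ := hmax
    have huv := hc.isInfix hocc hvA
    have hlt : u.length < v.length := by
      refine lt_of_le_of_ne huv.length_le fun hlen => ?_
      have hj : L.length = j := by have := hc.1; have := hc.2; omega
      exact hne hj (huv.eq_of_length hlen)
    have hvl := hvA.length_le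
    have hvA' : v <:+: A := let ⟨L', R', h, _⟩ := hvA; ⟨L', R', h.symm⟩
    exact (LambdaLe.of_forall_isMaxOcc hS' hA hv hvA').of_infix hS' huv
termination_by A.length - u.length

theorem LambdaLe.of_infix_flatten {α : Type*} {M S' : Set (Word α)} (hM : SubwordClosed M)
    {m : ℕ} {blocks : List (Word α)} (hblocks : ∀ b ∈ blocks, b ∉ M)
    (hle : ∀ b ∈ blocks, ∀ v ∈ M, v <:+: b → LambdaLe S' v m)
    {u : Word α} (hu : u ∈ M) (h : u <:+: blocks.flatten) : LambdaLe S' u (2 * m) := by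
  induction blocks with
  | nil => exact ⟨[], by simp, by simpa using h, by simp⟩
  | cons b bs ih =>
    rw [List.flatten_cons] at h
    rcases List.infix_append_iff.1 h with h | h | ⟨s, t, rfl, hs, ht⟩
    · exact (hle b (by simp) u hu h).mono (by omega)
    · exact ih (fun c hc => hblocks c (by simp [hc])) (fun c hc => hle c (by simp [hc])) h
    · have hsM : s ∈ M := hM _ hu s (List.prefix_append s t).isInfix
      have htM : t ∈ M := hM _ hu t (List.suffix_append s t).isInfix
      have hs' := hle b (by simp) s hsM hs.isInfix
      rw [two_mul]
      refine hs'.append ?_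
      cases bs with
      | nil => exact ⟨[], by simp, by simpa using ht, by simp⟩
      | cons c cs =>
        rw [List.flatten_cons] at ht
        rcases List.prefix_or_prefix_of_prefix ht (List.prefix_append c _) with h | h
        · exact hle c (by simp) t htM h.isInfix
        · exact absurd (hM t htM c h.isInfix) (hblocks c (by simp))


theorem small_accumulation {α : Type*} (Mon S' : Set (Word α)) (μ : ℕ)
    (hMon : SubwordClosed Mon)
    (hS'empty : ([] : Word α) ∈ S') (hS'sub : SubwordClosed S')
    (w1 w2 : Word α)
    (hc1 : CyclicallyReduced w1) (hc2 : CyclicallyReduced w2)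
    (hm1 : w1 ∉ Mon) (hm2 : w2 ∉ Mon)
    (h12 : Reduced (w1 ++ w2)) (h21 : Reduced (w2 ++ w1))
    (hμ1 : ∀ i u, IsMaxOcc Mon w1 i u → LambdaLe S' u μ)
    (hμ2 : ∀ i u, IsMaxOcc Mon w2 i u → LambdaLe S' u μ)
    (blocks : List (Word α)) (hblocks : ∀ b ∈ blocks, b = w1 ∨ b = w2) :
    ∀ i u, IsMaxOcc Mon blocks.flatten i u → LambdaLe S' u (2 * μ) := by
  rintro i u ⟨hu, ⟨L, R, hLR, -⟩, -⟩
  refine LambdaLe.of_infix_flatten hMon ?_ ?_ hu ⟨L, R, hLR.symm⟩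
  · intro b hb
    rcases hblocks b hb with rfl | rfl <;> assumption
  · intro b hb v hv hvb
    rcases hblocks b hb with rfl | rfl
    · exact LambdaLe.of_forall_isMaxOcc hS'sub hμ1 hv hvb
    · exact LambdaLe.of_forall_isMaxOcc hS'sub hμ2 hv hvb
end

section
/- Let w1 and w2 be non-empty reduced words in a free group F such that w1 and w2 have no common non-empty suffix and all the products w1·w1, w2·w2, w1·w2, and w2·w1 have no cancellations. Then the monoid homomorphism from the free monoid on two generators to F sending the generators to w1 and w2 is injective; equivalently, two distinct formal words over {w1, w2} yield graphically different reduced words over the generators of F. -/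
theorem Reduced.isReduced {α : Type*} {w : Word α} (h : Reduced w) : FreeGroup.IsReduced w :=
  List.IsChain.imp (fun a b hab h1 => by
    cases ha : a.2 <;> cases hb : b.2 <;> simp_all) h

/-- A concatenation of nonempty blocks is reduced as soon as the product of any two of the blocks
has no cancellations. -/
theorem FreeGroup.isReduced_flatMap {α ι : Type*} (f : ι → Word α) (hne : ∀ i, f i ≠ [])
    (hf : ∀ i j, FreeGroup.IsReduced (f i ++ f j)) (u : List ι) :
    FreeGroup.IsReduced (u.flatMap f) := by
  rw [List.flatMap_def, FreeGroup.IsReduced, List.isChain_flatten (by simpa using fun i _ => hne i)]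
  refine ⟨?_, ?_⟩
  · intro l hl
    obtain ⟨i, -, rfl⟩ := List.mem_map.1 hl
    exact (List.isChain_append.1 (hf i i)).1
  · rw [List.isChain_map]
    exact (List.pairwise_of_forall fun i j => (List.isChain_append.1 (hf i j)).2.2).isChain

theorem FreeGroup.lift_mk_eq_mk_flatMap {α ι : Type*} (f : ι → Word α) (u : FreeMonoid ι) :
    FreeMonoid.lift (fun i => FreeGroup.mk (f i)) u = FreeGroup.mk (u.toList.flatMap f) := by
  induction u using FreeMonoid.inductionOn' with
  | one => rfl
  | of_mul i u ih => simp [ih, FreeGroup.mul_mk]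

/-- Nonempty words, no two of which have a common nonempty suffix, form a code. -/
theorem flatMap_injective_of_no_common_suffix {β ι : Type*} (f : ι → List β)
    (hne : ∀ i, f i ≠ [])
    (hsuf : ∀ i j, i ≠ j → ∀ s : List β, s <:+ f i → s <:+ f j → s = []) :
    Function.Injective fun u : List ι => u.flatMap f := by
  intro u
  induction u using List.reverseRecOn with
  | nil =>
    intro v h
    cases v with
    | nil => rfl
    | cons j v => simp [hne] at h
  | append_singleton u i ih =>
    intro v h
    rcases List.eq_nil_or_concat v with rfl | ⟨v, j, rfl⟩
    · simp [hne] at h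
    · simp only [List.concat_eq_append, List.flatMap_append, List.flatMap_singleton] at h
      have hij : i = j := by
        by_contra hij
        have hi : f i <:+ v.flatMap f ++ f j := h ▸ List.suffix_append _ _
        rcases List.suffix_or_suffix_of_suffix hi (List.suffix_append _ _) with hs | hs
        · exact hne i (hsuf i j hij _ List.suffix_rfl hs)
        · exact hne j (hsuf i j hij _ hs List.suffix_rfl)
      subst hij
      rw [List.concat_eq_append, ih (List.append_cancel_right h)]

/-- Let `w₁, w₂` be non-empty reduced words in a free group `F` with no
common non-empty suffix, such that all products `w₁·w₁`, `w₂·w₂`, `w₁·w₂`, `w₂·w₁` have no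
cancellations. Then the monoid homomorphism from the free monoid on two generators to `F`
sending the generators to `w₁` and `w₂` is injective: distinct formal words over `{w₁, w₂}`
yield graphically different reduced words. -/
theorem free_monoid_injective {α : Type*} (w1 w2 : Word α)
    (h1 : w1 ≠ []) (h2 : w2 ≠ [])
    (h1r : Reduced w1) (h2r : Reduced w2)
    (hsuf : ¬ ∃ s : Word α, s ≠ [] ∧ s <:+ w1 ∧ s <:+ w2)
    (h11 : Reduced (w1 ++ w1)) (h22 : Reduced (w2 ++ w2))
    (h12 : Reduced (w1 ++ w2)) (h21 : Reduced (w2 ++ w1)) :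
    Function.Injective
      (FreeMonoid.lift (fun b : Fin 2 => FreeGroup.mk (if b = 0 then w1 else w2)) :
        FreeMonoid (Fin 2) →* FreeGroup α) := by
  set f : Fin 2 → Word α := fun b => if b = 0 then w1 else w2
  have hne : ∀ i, f i ≠ [] := by
    intro i
    fin_cases i <;> simpa [f]
  have hf : ∀ i j, FreeGroup.IsReduced (f i ++ f j) := by
    intro i j
    fin_cases i <;> fin_cases j
    exacts [h11.isReduced, h12.isReduced, h21.isReduced, h22.isReduced]
  have hs : ∀ s : Word α, s <:+ w1 → s <:+ w2 → s = [] := fun s hs1 hs2 =>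
    by_contra fun h => hsuf ⟨s, h, hs1, hs2⟩
  have hcode : ∀ i j, i ≠ j → ∀ s : Word α, s <:+ f i → s <:+ f j → s = [] := by
    intro i j hij s hsi hsj
    fin_cases i <;> fin_cases j
    exacts [absurd rfl hij, hs s hsi hsj, hs s hsj hsi, absurd rfl hij]
  classical
  intro u v huv
  change FreeMonoid.lift (fun i => FreeGroup.mk (f i)) u =
    FreeMonoid.lift (fun i => FreeGroup.mk (f i)) v at huv
  rw [FreeGroup.lift_mk_eq_mk_flatMap, FreeGroup.lift_mk_eq_mk_flatMap] at huv
  have h := congrArg FreeGroup.toWord huv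
  rw [FreeGroup.toWord_mk, FreeGroup.toWord_mk,
    (FreeGroup.isReduced_flatMap f hne hf _).reduce_eq,
    (FreeGroup.isReduced_flatMap f hne hf _).reduce_eq] at h
  exact FreeMonoid.toList.injective (flatMap_injective_of_no_common_suffix f hne hcode h)
end

section
/- Let Mon be a set of words closed under taking subwords and let W1, W2 be reduced words such that the product W1·W2 has no cancellations. Then MinCov(W1) + MinCov(W2) − 1 ≤ MinCov(W1W2) ≤ MinCov(W1) + MinCov(W2). -/
/-- The letter at position `j` of `A` is covered by some occurrence of an element of `M`. -/
def Covered {α : Type*} (M : Set (Word α)) (A : Word α) (j : ℕ) : Prop :=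
  ∃ (i : ℕ) (u : Word α), u ∈ M ∧ Occurs u A i ∧ i ≤ j ∧ j < i + u.length

/-- `MinCov M A`: the minimal number of maximal occurrences (with respect to `M`) in `A`
needed to cover all letters of `A` that belong to some occurrence of an element of `M`. -/
noncomputable def MinCov {α : Type*} (M : Set (Word α)) (A : Word α) : ℕ :=
  sInf { n | ∃ T : Finset (ℕ × Word α), (∀ o ∈ T, IsMaxOcc M A o.1 o.2) ∧ T.card = n ∧
    ∀ j, Covered M A j → ∃ o ∈ T, o.1 ≤ j ∧ j < o.1 + o.2.length }

theorem occurs_iff {α : Type*} {u A : Word α} {i : ℕ} :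
    Occurs u A i ↔ i + u.length ≤ A.length ∧ ∀ k < u.length, A[i + k]? = u[k]? := by
  constructor
  · rintro ⟨L, R, rfl, rfl⟩
    refine ⟨by simp, fun k hk => ?_⟩
    rw [List.append_assoc, List.getElem?_append_right (by omega), Nat.add_sub_cancel_left,
      List.getElem?_append_left hk]
  · rintro ⟨hle, hget⟩
    have hu : u = (A.drop i).take u.length := by
      refine List.ext_getElem? fun k => ?_
      rw [List.getElem?_take, List.getElem?_drop]
      split_ifs with hk
      · exact (hget k hk).symm
      · exact List.getElem?_eq_none (by omega)
    refine ⟨A.take i, (A.drop i).drop u.length, ?_, by simp; omega⟩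
    calc A = A.take i ++ ((A.drop i).take u.length ++ (A.drop i).drop u.length) := by
          rw [List.take_append_drop, List.take_append_drop]
      _ = A.take i ++ u ++ (A.drop i).drop u.length := by rw [← hu, List.append_assoc]

theorem Occurs.eq_of_length_eq {α : Type*} {u v A : Word α} {i : ℕ} (hu : Occurs u A i)
    (hv : Occurs v A i) (h : u.length = v.length) : u = v := by
  obtain ⟨L, R, rfl, rfl⟩ := hu
  obtain ⟨L', R', h', hL⟩ := hv
  rw [List.append_assoc, List.append_assoc] at h'
  exact (List.append_inj (List.append_inj h' hL.symm).2 h).1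

theorem Occurs.append_right {α : Type*} {u A : Word α} {i : ℕ} (h : Occurs u A i) (B : Word α) :
    Occurs u (A ++ B) i := by
  obtain ⟨L, R, rfl, rfl⟩ := h
  exact ⟨L, R ++ B, by simp, rfl⟩

theorem Occurs.append_left {α : Type*} {u B : Word α} {i : ℕ} (A : Word α) (h : Occurs u B i) :
    Occurs u (A ++ B) (A.length + i) := by
  obtain ⟨L, R, rfl, rfl⟩ := h
  exact ⟨A ++ L, R, by simp, by simp⟩

/-- The part of an occurrence in a product that lies in the left factor. -/
theorem Occurs.take_of_append {α : Type*} {u A B : Word α} {i : ℕ} (h : Occurs u (A ++ B) i)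
    (hi : i ≤ A.length) : Occurs (u.take (A.length - i)) A i := by
  rw [occurs_iff] at h ⊢
  refine ⟨by rw [List.length_take]; omega, fun k hk => ?_⟩
  rw [List.length_take] at hk
  rw [List.getElem?_take_of_lt (by omega), ← h.2 k (by omega),
    List.getElem?_append_left (by omega)]

/-- The part of an occurrence in a product that lies in the right factor. -/
theorem Occurs.drop_of_append {α : Type*} {u A B : Word α} {i : ℕ} (h : Occurs u (A ++ B) i)
    (hi : A.length ≤ i + u.length) :
    Occurs (u.drop (A.length - i)) B (i - A.length) := by
  rw [occurs_iff] at h ⊢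
  rw [List.length_append] at h
  refine ⟨by rw [List.length_drop]; omega, fun k hk => ?_⟩
  rw [List.length_drop] at hk
  rw [List.getElem?_drop, ← h.2 _ (by omega), List.getElem?_append_right (by omega)]
  congr 1
  omega

/-- A finite family of occurrences of elements of `M` in `A`, not necessarily maximal, that
covers every covered letter of `A`. -/
def IsOccCover {α : Type*} (M : Set (Word α)) (A : Word α) (T : Finset (ℕ × Word α)) : Prop :=
  (∀ o ∈ T, o.2 ∈ M ∧ Occurs o.2 A o.1) ∧
    ∀ j, Covered M A j → ∃ o ∈ T, o.1 ≤ j ∧ j < o.1 + o.2.length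

theorem exists_isMaxOcc {α : Type*} {M : Set (Word α)} {A u : Word α} {i : ℕ} (hu : u ∈ M)
    (h : Occurs u A i) : ∃ o : ℕ × Word α, IsMaxOcc M A o.1 o.2 ∧ OccContained i u o.1 o.2 := by
  induction hn : A.length - u.length using Nat.strong_induction_on generalizing i u with
  | _ n ih =>
    by_cases hmax : IsMaxOcc M A i u
    · exact ⟨(i, u), hmax, le_rfl, le_rfl⟩
    · simp only [IsMaxOcc, hu, h, true_and, not_forall] at hmax
      obtain ⟨j, v, hv, hvA, hc, hne⟩ := hmax
      have hvlen := (occurs_iff.1 hvA).1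
      have hlt : u.length < v.length := by
        by_contra hle
        have hij : i = j := by have := hc.1; have := hc.2; omega
        subst hij
        exact hne ⟨rfl, h.eq_of_length_eq hvA (by have := hc.2; omega)⟩
      obtain ⟨o, ho, hco⟩ := ih _ (by omega) hv hvA rfl
      exact ⟨o, ho, hco.1.trans hc.1, hc.2.trans hco.2⟩

theorem IsOccCover.exists_isMaxOcc_cover {α : Type*} {M : Set (Word α)} {A : Word α}
    {T : Finset (ℕ × Word α)} (hT : IsOccCover M A T) :
    ∃ T' : Finset (ℕ × Word α), (∀ o ∈ T', IsMaxOcc M A o.1 o.2) ∧ T'.card ≤ T.card ∧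
      ∀ j, Covered M A j → ∃ o ∈ T', o.1 ≤ j ∧ j < o.1 + o.2.length := by
  classical
  have hext : ∀ o : ℕ × Word α, ∃ p : ℕ × Word α,
      o ∈ T → IsMaxOcc M A p.1 p.2 ∧ OccContained o.1 o.2 p.1 p.2 := fun o => by
    by_cases ho : o ∈ T
    · obtain ⟨p, hp⟩ := exists_isMaxOcc (hT.1 o ho).1 (hT.1 o ho).2
      exact ⟨p, fun _ => hp⟩
    · exact ⟨o, fun h => absurd h ho⟩
  choose f hf using hext
  refine ⟨T.image f, ?_, Finset.card_image_le, fun j hj => ?_⟩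
  · simp only [Finset.mem_image]
    rintro _ ⟨o, ho, rfl⟩
    exact (hf o ho).1
  · obtain ⟨o, ho, h1, h2⟩ := hT.2 j hj
    obtain ⟨h3, h4⟩ := (hf o ho).2
    exact ⟨f o, Finset.mem_image_of_mem f ho, h3.trans h1, h2.trans_le h4⟩

theorem IsOccCover.minCov_le {α : Type*} {M : Set (Word α)} {A : Word α}
    {T : Finset (ℕ × Word α)} (hT : IsOccCover M A T) : MinCov M A ≤ T.card := by
  obtain ⟨T', hmax, hcard, hcov⟩ := hT.exists_isMaxOcc_cover
  have hle : MinCov M A ≤ T'.card := Nat.sInf_le ⟨T', hmax, rfl, hcov⟩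
  exact hle.trans hcard

theorem exists_isOccCover {α : Type*} (M : Set (Word α)) (A : Word α) :
    ∃ T, IsOccCover M A T := by
  classical
  have hocc : ∀ j : ℕ, ∃ o : ℕ × Word α, Covered M A j →
      (o.2 ∈ M ∧ Occurs o.2 A o.1) ∧ o.1 ≤ j ∧ j < o.1 + o.2.length := fun j => by
    by_cases hj : Covered M A j
    · obtain ⟨i, u, hu, hA, h⟩ := hj
      exact ⟨(i, u), fun _ => ⟨⟨hu, hA⟩, h⟩⟩
    · exact ⟨(0, []), fun h => absurd h hj⟩
  choose f hf using hocc
  refine ⟨((Finset.range A.length).filter (Covered M A)).image f, ?_, fun j hj => ?_⟩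
  · simp only [Finset.mem_image, Finset.mem_filter]
    rintro _ ⟨j, ⟨-, hj⟩, rfl⟩
    exact (hf j hj).1
  · refine ⟨f j, Finset.mem_image_of_mem f ?_, (hf j hj).2⟩
    obtain ⟨i, u, -, hA, -, hlt⟩ := id hj
    simp only [Finset.mem_filter, Finset.mem_range]
    exact ⟨hlt.trans_le (occurs_iff.1 hA).1, hj⟩

theorem exists_isOccCover_card_eq_minCov {α : Type*} (M : Set (Word α)) (A : Word α) :
    ∃ T, IsOccCover M A T ∧ T.card = MinCov M A := by
  obtain ⟨T₀, hT₀⟩ := exists_isOccCover M A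
  obtain ⟨T₁, hmax₁, -, hcov₁⟩ := hT₀.exists_isMaxOcc_cover
  obtain ⟨T, hmax, hcard, hcov⟩ : MinCov M A ∈ { n | ∃ T : Finset (ℕ × Word α),
      (∀ o ∈ T, IsMaxOcc M A o.1 o.2) ∧ T.card = n ∧
        ∀ j, Covered M A j → ∃ o ∈ T, o.1 ≤ j ∧ j < o.1 + o.2.length } :=
    Nat.sInf_mem ⟨_, T₁, hmax₁, rfl, hcov₁⟩
  exact ⟨T, ⟨fun o ho => ⟨(hmax o ho).1, (hmax o ho).2.1⟩, hcov⟩, hcard⟩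

theorem Covered.append_right {α : Type*} {M : Set (Word α)} {A : Word α} {j : ℕ}
    (h : Covered M A j) (B : Word α) : Covered M (A ++ B) j := by
  obtain ⟨i, u, hu, hA, h⟩ := h
  exact ⟨i, u, hu, hA.append_right B, h⟩

theorem Covered.append_left {α : Type*} {M : Set (Word α)} {B : Word α} {j : ℕ} (A : Word α)
    (h : Covered M B j) : Covered M (A ++ B) (A.length + j) := by
  obtain ⟨i, u, hu, hB, h1, h2⟩ := h
  exact ⟨A.length + i, u, hu, hB.append_left A, by omega, by omega⟩

theorem Covered.lt_length {α : Type*} {M : Set (Word α)} {A : Word α} {j : ℕ}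
    (h : Covered M A j) : j < A.length := by
  obtain ⟨i, u, -, hA, -, h⟩ := h
  exact h.trans_le (occurs_iff.1 hA).1

theorem Covered.of_append_of_lt {α : Type*} {M : Set (Word α)} (hM : SubwordClosed M)
    {A B : Word α} {j : ℕ} (h : Covered M (A ++ B) j) (hj : j < A.length) : Covered M A j := by
  obtain ⟨i, u, hu, hA, h1, h2⟩ := h
  refine ⟨i, _, hM u hu _ (List.take_prefix _ _).isInfix, hA.take_of_append (by omega), h1, ?_⟩
  rw [List.length_take]
  omega

theorem Covered.of_append_of_le {α : Type*} {M : Set (Word α)} (hM : SubwordClosed M)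
    {A B : Word α} {j : ℕ} (h : Covered M (A ++ B) j) (hj : A.length ≤ j) :
    Covered M B (j - A.length) := by
  obtain ⟨i, u, hu, hA, h1, h2⟩ := h
  refine ⟨_, _, hM u hu _ (List.drop_suffix _ _).isInfix, hA.drop_of_append (by omega), ?_, ?_⟩
  · omega
  · rw [List.length_drop]
    omega

theorem minCov_append_le {α : Type*} {M : Set (Word α)} (hM : SubwordClosed M) (A B : Word α) :
    MinCov M (A ++ B) ≤ MinCov M A + MinCov M B := by
  classical
  obtain ⟨S, hS, hScard⟩ := exists_isOccCover_card_eq_minCov M A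
  obtain ⟨T, hT, hTcard⟩ := exists_isOccCover_card_eq_minCov M B
  let shift : ℕ × Word α → ℕ × Word α := fun o => (A.length + o.1, o.2)
  have hcov : IsOccCover M (A ++ B) (S ∪ T.image shift) := by
    refine ⟨fun o ho => ?_, fun j hj => ?_⟩
    · rcases Finset.mem_union.1 ho with ho | ho
      · exact ⟨(hS.1 o ho).1, (hS.1 o ho).2.append_right B⟩
      · obtain ⟨p, hp, rfl⟩ := Finset.mem_image.1 ho
        exact ⟨(hT.1 p hp).1, (hT.1 p hp).2.append_left A⟩
    · rcases lt_or_ge j A.length with hlt | hle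
      · obtain ⟨o, ho, h⟩ := hS.2 j (hj.of_append_of_lt hM hlt)
        exact ⟨o, Finset.mem_union_left _ ho, h⟩
      · obtain ⟨o, ho, h1, h2⟩ := hT.2 _ (hj.of_append_of_le hM hle)
        refine ⟨shift o, Finset.mem_union_right _ (Finset.mem_image_of_mem _ ho), ?_, ?_⟩ <;>
          dsimp only [shift] <;> omega
  calc MinCov M (A ++ B) ≤ (S ∪ T.image shift).card := hcov.minCov_le
    _ ≤ S.card + (T.image shift).card := Finset.card_union_le _ _
    _ ≤ S.card + T.card := Nat.add_le_add_left Finset.card_image_le _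
    _ = MinCov M A + MinCov M B := by rw [hScard, hTcard]

/-- Cut the members of `T` down to the left factor. -/
theorem minCov_le_card_of_append_right {α : Type*} {M : Set (Word α)} (hM : SubwordClosed M)
    {A B : Word α} {T : Finset (ℕ × Word α)}
    (hT : ∀ o ∈ T, o.2 ∈ M ∧ Occurs o.2 (A ++ B) o.1 ∧ o.1 ≤ A.length)
    (hcov : ∀ j, Covered M A j → ∃ o ∈ T, o.1 ≤ j ∧ j < o.1 + o.2.length) :
    MinCov M A ≤ T.card := by
  classical
  have hcut : IsOccCover M A (T.image fun o : ℕ × Word α => (o.1, o.2.take (A.length - o.1))) := by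
    refine ⟨fun o ho => ?_, fun j hj => ?_⟩
    · obtain ⟨p, hp, rfl⟩ := Finset.mem_image.1 ho
      obtain ⟨h1, h2, h3⟩ := hT p hp
      exact ⟨hM _ h1 _ (List.take_prefix _ _).isInfix, h2.take_of_append h3⟩
    · obtain ⟨o, ho, h1, h2⟩ := hcov j hj
      have := hj.lt_length
      refine ⟨_, Finset.mem_image_of_mem _ ho, h1, ?_⟩
      simp only [List.length_take]
      omega
  exact hcut.minCov_le.trans Finset.card_image_le

/-- Cut the members of `T` down to the right factor. -/
theorem minCov_le_card_of_append_left {α : Type*} {M : Set (Word α)} (hM : SubwordClosed M)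
    {A B : Word α} {T : Finset (ℕ × Word α)}
    (hT : ∀ o ∈ T, o.2 ∈ M ∧ Occurs o.2 (A ++ B) o.1 ∧ A.length ≤ o.1 + o.2.length)
    (hcov : ∀ j, Covered M B j →
      ∃ o ∈ T, o.1 ≤ A.length + j ∧ A.length + j < o.1 + o.2.length) :
    MinCov M B ≤ T.card := by
  classical
  have hcut : IsOccCover M B
      (T.image fun o : ℕ × Word α => (o.1 - A.length, o.2.drop (A.length - o.1))) := by
    refine ⟨fun o ho => ?_, fun j hj => ?_⟩
    · obtain ⟨p, hp, rfl⟩ := Finset.mem_image.1 ho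
      obtain ⟨h1, h2, h3⟩ := hT p hp
      exact ⟨hM _ h1 _ (List.drop_suffix _ _).isInfix, h2.drop_of_append h3⟩
    · obtain ⟨o, ho, h1, h2⟩ := hcov j hj
      refine ⟨_, Finset.mem_image_of_mem _ ho, ?_, ?_⟩
      · simp only
        omega
      · simp only [List.length_drop]
        omega
  exact hcut.minCov_le.trans Finset.card_image_le

theorem Finset.exists_subset_card_le_one_forall_le {β γ : Type*} [LinearOrder γ] (s : Finset β)
    (f : β → γ) : ∃ t ⊆ s, t.card ≤ 1 ∧ ∀ x ∈ s, ∃ y ∈ t, f y ≤ f x := by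
  rcases s.eq_empty_or_nonempty with rfl | hs
  · exact ⟨∅, by simp⟩
  · obtain ⟨y, hy, hmin⟩ := s.exists_min_image f hs
    exact ⟨{y}, by simpa using hy, by simp, by simpa using hmin⟩

/-- Among the occurrences that cross the boundary between the factors, one suffices on each
side: the one that starts first for `A` and the one that ends last for `B`. -/
theorem minCov_add_minCov_le {α : Type*} {M : Set (Word α)} (hM : SubwordClosed M)
    (A B : Word α) : MinCov M A + MinCov M B ≤ MinCov M (A ++ B) + 1 := by
  classical
  obtain ⟨T, ⟨hT, hcov⟩, hcard⟩ := exists_isOccCover_card_eq_minCov M (A ++ B)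
  let L := T.filter fun o => o.1 + o.2.length ≤ A.length
  let N := T.filter fun o => ¬o.1 + o.2.length ≤ A.length
  let R := N.filter fun o => A.length ≤ o.1
  let C := N.filter fun o => ¬A.length ≤ o.1
  have hLN : L.card + N.card = T.card := Finset.card_filter_add_card_filter_not _
  have hRC : R.card + C.card = N.card := Finset.card_filter_add_card_filter_not _
  obtain ⟨C₁, hC₁, hC₁card, hfirst⟩ := C.exists_subset_card_le_one_forall_le fun o => o.1
  obtain ⟨C₂, hC₂, hC₂card, hlast⟩ :=
    C.exists_subset_card_le_one_forall_le fun o => OrderDual.toDual (o.1 + o.2.length)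
  have hCcard : C₁.card ≤ C.card := Finset.card_le_card hC₁
  have memL : ∀ o, o ∈ L ↔ o ∈ T ∧ o.1 + o.2.length ≤ A.length := fun o =>
    Finset.mem_filter
  have memR : ∀ o, o ∈ R ↔ o ∈ T ∧ A.length < o.1 + o.2.length ∧ A.length ≤ o.1 := fun o => by
    simp only [R, N, Finset.mem_filter, and_assoc]
    refine and_congr_right fun _ => ?_
    omega
  have memC : ∀ o, o ∈ C ↔ o ∈ T ∧ A.length < o.1 + o.2.length ∧ o.1 < A.length := fun o => by
    simp only [C, N, Finset.mem_filter, and_assoc]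
    refine and_congr_right fun _ => ?_
    omega
  have hA : MinCov M A ≤ (L ∪ C₁).card := by
    refine minCov_le_card_of_append_right hM (B := B) (fun o ho => ?_) fun j hj => ?_
    · have ho' : o ∈ T ∧ o.1 ≤ A.length := by
        rcases Finset.mem_union.1 ho with ho | ho
        · rw [memL] at ho
          exact ⟨ho.1, by omega⟩
        · have := (memC o).1 (hC₁ ho)
          exact ⟨this.1, by omega⟩
      exact ⟨(hT o ho'.1).1, (hT o ho'.1).2, ho'.2⟩
    · have hjA := hj.lt_length
      obtain ⟨o, ho, h1, h2⟩ := hcov j (hj.append_right B)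
      rcases le_or_gt (o.1 + o.2.length) A.length with hle | hlt
      · exact ⟨o, Finset.mem_union_left _ ((memL o).2 ⟨ho, hle⟩), h1, h2⟩
      · obtain ⟨p, hp, hpo⟩ := hfirst o ((memC o).2 ⟨ho, hlt, by omega⟩)
        have := (memC p).1 (hC₁ hp)
        exact ⟨p, Finset.mem_union_right _ hp, by omega, by omega⟩
  have hB : MinCov M B ≤ (R ∪ C₂).card := by
    refine minCov_le_card_of_append_left hM (A := A) (fun o ho => ?_) fun j hj => ?_
    · have ho' : o ∈ T ∧ A.length ≤ o.1 + o.2.length := by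
        rcases Finset.mem_union.1 ho with ho | ho
        · rw [memR] at ho
          exact ⟨ho.1, by omega⟩
        · have := (memC o).1 (hC₂ ho)
          exact ⟨this.1, by omega⟩
      exact ⟨(hT o ho'.1).1, (hT o ho'.1).2, ho'.2⟩
    · obtain ⟨o, ho, h1, h2⟩ := hcov _ (hj.append_left A)
      rcases le_or_gt A.length o.1 with hle | hlt
      · exact ⟨o, Finset.mem_union_left _ ((memR o).2 ⟨ho, by omega, hle⟩), h1, h2⟩
      · obtain ⟨p, hp, hpo⟩ := hlast o ((memC o).2 ⟨ho, by omega, hlt⟩)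
        rw [OrderDual.toDual_le_toDual] at hpo
        have := (memC p).1 (hC₂ hp)
        exact ⟨p, Finset.mem_union_right _ hp, by omega, by omega⟩
  have hLC := Finset.card_union_le L C₁
  have hRC₂ := Finset.card_union_le R C₂
  omega

/-- Let `Mon` be subword-closed and `W₁, W₂` reduced words such that the
product `W₁·W₂` has no cancellations. Then
`MinCov(W₁) + MinCov(W₂) − 1 ≤ MinCov(W₁W₂) ≤ MinCov(W₁) + MinCov(W₂)`. -/
theorem minCov_append {α : Type*} (Mon : Set (Word α)) (hMon : SubwordClosed Mon)
    (W1 W2 : Word α) (h1 : Reduced W1) (h2 : Reduced W2) (h12 : Reduced (W1 ++ W2)) :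
    MinCov Mon W1 + MinCov Mon W2 - 1 ≤ MinCov Mon (W1 ++ W2) ∧
    MinCov Mon (W1 ++ W2) ≤ MinCov Mon W1 + MinCov Mon W2 := by
  exact ⟨Nat.sub_le_iff_le_add.2 (minCov_add_minCov_le hMon W1 W2), minCov_append_le hMon W1 W2⟩
end

section
/- Let k be a field. The free associative algebra k⟨x, y⟩ on two free generators is non-amenable in the sense of Bartholdi. -/
/-- `dim_k((F + sF) / F)` for a linear subspace `F` of a `k`-algebra `R` and `s : R`,
where `sF` is the image of `F` under left multiplication by `s`. -/
noncomputable def sMulQuotDim (k : Type*) {R : Type*} [Field k] [Ring R] [Algebra k R]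
    (s : R) (F : Submodule k R) : ℕ :=
  Module.finrank k
    (↥(F ⊔ F.map (LinearMap.mulLeft k s)) ⧸
      Submodule.comap (F ⊔ F.map (LinearMap.mulLeft k s)).subtype F)

/-- An algebra `R` over a field `k` is *non-amenable* in the sense of Bartholdi if there exist
`ε > 0` and a finite-dimensional subspace `S ⊆ R` such that for every finite-dimensional
nonzero subspace `F ⊆ R` there is `s ∈ S` with `dim_k((F + sF)/F) ≥ ε · dim_k F`. -/
def IsNonamenableAlg (k R : Type*) [Field k] [Ring R] [Algebra k R] : Prop :=
  ∃ ε : ℝ, 0 < ε ∧ ∃ S : Submodule k R, FiniteDimensional k S ∧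
    ∀ F : Submodule k R, FiniteDimensional k F → F ≠ ⊥ →
      ∃ s ∈ S, ε * (Module.finrank k F : ℝ) ≤ (sMulQuotDim k s F : ℝ)

/-- An algebra `R` over a field `k` is *amenable* in the sense of Bartholdi if for every
`ε > 0` and every finite-dimensional subspace `S ⊆ R` there exists a finite-dimensional
nonzero subspace `F ⊆ R` such that `dim_k((F + sF)/F) < ε · dim_k F` for all `s ∈ S`. -/
def IsAmenableAlg (k R : Type*) [Field k] [Ring R] [Algebra k R] : Prop :=
  ∀ ε : ℝ, 0 < ε → ∀ S : Submodule k R, FiniteDimensional k S →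
    ∃ F : Submodule k R, FiniteDimensional k F ∧ F ≠ ⊥ ∧
      ∀ s ∈ S, (sMulQuotDim k s F : ℝ) < ε * (Module.finrank k F : ℝ)

theorem FreeAlgebra.eq_zero_of_ι_mul_eq_ι_mul {R X : Type*} [CommSemiring R] {i j : X}
    (hij : i ≠ j) {a b : FreeAlgebra R X} (h : ι R i * a = ι R j * b) : a = 0 := by
  let e := equivMonoidAlgebraFreeMonoid (R := R) (X := X)
  have he (l : X) : e (ι R l) = MonoidAlgebra.single (FreeMonoid.of l) 1 := by
    simp [e, equivMonoidAlgebraFreeMonoid]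
  have h' := congrArg e h
  rw [map_mul, map_mul, he, he] at h'
  apply e.injective
  rw [map_zero]
  ext w
  have hw := congrArg (fun f ↦ f.coeff (FreeMonoid.of i * w)) h'
  have h₁ : (MonoidAlgebra.single (FreeMonoid.of i) (1 : R) * e a).coeff (FreeMonoid.of i * w) =
      (e a).coeff w := by
    rw [MonoidAlgebra.coeff_single_mul_eq_mul_coeff w, one_mul]
    exact fun _ _ ↦ mul_right_inj _
  have h₂ : (MonoidAlgebra.single (FreeMonoid.of j) (1 : R) * e b).coeff (FreeMonoid.of i * w) =
      0 := by
    refine MonoidAlgebra.coeff_single_mul_of_forall_mul_ne _ _ fun d hd ↦ hij ?_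
    have hd' := congrArg FreeMonoid.toList hd
    simp only [FreeMonoid.toList_mul, FreeMonoid.toList_of, List.singleton_append,
      List.cons.injEq] at hd'
    exact hd'.1.symm
  simpa [h₁, h₂] using hw

theorem sMulQuotDim_add_finrank {k R : Type*} [Field k] [Ring R] [Algebra k R]
    (s : R) (F : Submodule k R) [FiniteDimensional k F] :
    sMulQuotDim k s F + Module.finrank k F =
      Module.finrank k ↥(F ⊔ F.map (LinearMap.mulLeft k s)) := by
  rw [sMulQuotDim, ← (Submodule.comapSubtypeEquivOfLe
    (le_sup_left : F ≤ F ⊔ F.map (LinearMap.mulLeft k s))).finrank_eq]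
  exact Submodule.finrank_quotient_add_finrank _

theorem finrank_le_sMulQuotDim_add {k R : Type*} [Field k] [Ring R] [Algebra k R] {s t : R}
    (hs : Function.Injective (s * ·)) (ht : Function.Injective (t * ·))
    (hst : ∀ a b : R, s * a = t * b → a = 0) (F : Submodule k R) [FiniteDimensional k F] :
    Module.finrank k F ≤ sMulQuotDim k s F + sMulQuotDim k t F := by
  let A := F.map (LinearMap.mulLeft k s)
  let B := F.map (LinearMap.mulLeft k t)
  have hA : Module.finrank k A = Module.finrank k F :=
    (Submodule.equivMapOfInjective (LinearMap.mulLeft k s) hs F).finrank_eq.symm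
  have hB : Module.finrank k B = Module.finrank k F :=
    (Submodule.equivMapOfInjective (LinearMap.mulLeft k t) ht F).finrank_eq.symm
  have hAB : A ⊓ B = ⊥ := by
    rw [eq_bot_iff]
    rintro _ ⟨⟨a, -, rfl⟩, b, -, hb⟩
    simp [hst a b hb.symm]
  have hsupAB := Submodule.finrank_sup_add_finrank_inf_eq A B
  rw [hAB, finrank_bot] at hsupAB
  have hsup := Submodule.finrank_sup_add_finrank_inf_eq (F ⊔ A) (F ⊔ B)
  have hle : Module.finrank k ↥(A ⊔ B) ≤ Module.finrank k ↥(F ⊔ A ⊔ (F ⊔ B)) :=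
    Submodule.finrank_mono (sup_le_sup le_sup_right le_sup_right)
  have hinf : Module.finrank k F ≤ Module.finrank k ↥((F ⊔ A) ⊓ (F ⊔ B)) :=
    Submodule.finrank_mono (le_inf le_sup_left le_sup_left)
  have hS : sMulQuotDim k s F + Module.finrank k F = Module.finrank k ↥(F ⊔ A) :=
    sMulQuotDim_add_finrank s F
  have hT : sMulQuotDim k t F + Module.finrank k F = Module.finrank k ↥(F ⊔ B) :=
    sMulQuotDim_add_finrank t F
  omega

/-- The free associative algebra `k⟨x, y⟩` on two free generators over a
field `k` is non-amenable in the sense of Bartholdi. -/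
theorem free_algebra_nonamenable (k : Type*) [Field k] :
    IsNonamenableAlg k (FreeAlgebra k (Fin 2)) := by
  have hinj (i : Fin 2) : Function.Injective (FreeAlgebra.ι k i * ·) :=
    mul_right_injective₀ (FreeAlgebra.ι_ne_zero i)
  refine ⟨1 / 2, by norm_num, Submodule.span k (Set.range (FreeAlgebra.ι k)),
    FiniteDimensional.span_of_finite k (Set.finite_range _), fun F _ _ ↦ ?_⟩
  have h := finrank_le_sMulQuotDim_add (hinj 0) (hinj 1)
    (fun _ _ ↦ FreeAlgebra.eq_zero_of_ι_mul_eq_ι_mul zero_ne_one) F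
  have h' : (Module.finrank k F : ℝ) ≤
      sMulQuotDim k (FreeAlgebra.ι k (0 : Fin 2)) F +
        sMulQuotDim k (FreeAlgebra.ι k (1 : Fin 2)) F := by
    exact_mod_cast h
  by_contra! hlt
  have h₀ := hlt _ (Submodule.subset_span (Set.mem_range_self 0))
  have h₁ := hlt _ (Submodule.subset_span (Set.mem_range_self 1))
  linarith
end

section
/- Let w1 and w2 be non-empty cyclically reduced words in a free group F such that the products w1·w2 and w2·w1 have no cancellations, w1 and w2 have no common non-empty suffix, and w1 is not a proper power. For i = 1, 2, 3 define v_i = w2 w1^{γ_i} w2 w1^{γ_i + 1} ⋯ w2 w1^{δ_i} w2, where the integer parameters satisfy γ_1 ≥ 90, δ_i ≥ γ_i + 90, and γ_{i+1} ≥ δ_i + 90. Then for any two distinct words A1, A2 ∈ {v_1^{±1}, v_2^{±1}, v_3^{±1}}, their longest common prefix c satisfies |c| < (1/30)|A_1| and |c| < (1/30)|A_2|. -/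
/-- The `n`-th power `w^n` of a word, as a concatenation. -/
def listPow {α : Type*} (w : Word α) (n : ℕ) : Word α := (List.replicate n w).flatten

/-- The formal inverse `w⁻¹` of a reduced word. -/
def wordInv {α : Type*} (w : Word α) : Word α := (w.map fun l => (l.1, !l.2)).reverse

/-- `InMonoid a b w` : the list `w` is a concatenation of copies of `a` and `b`. -/
inductive InMonoid {β : Type*} (a b : List β) : List β → Prop
  | nil : InMonoid a b []
  | left {w : List β} : InMonoid a b w → InMonoid a b (a ++ w)
  | right {w : List β} : InMonoid a b w → InMonoid a b (b ++ w)

namespace InMonoid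

variable {β : Type*} {a b : List β}

theorem swap {w : List β} (h : InMonoid a b w) : InMonoid b a w := by
  induction h with
  | nil => exact .nil
  | left _ ih => exact .right ih
  | right _ ih => exact .left ih

theorem append {w x : List β} (hw : InMonoid a b w) (hx : InMonoid a b x) :
    InMonoid a b (w ++ x) := by
  induction hw with
  | nil => exact hx
  | left _ ih => rw [List.append_assoc]; exact .left ih
  | right _ ih => rw [List.append_assoc]; exact .right ih

theorem left_self : InMonoid a b a := by simpa using (left nil : InMonoid a b (a ++ []))

theorem right_self : InMonoid a b b := by simpa using (right nil : InMonoid a b (b ++ []))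

theorem of_append_right {w : List β} (h : InMonoid a (a ++ b) w) : InMonoid a b w := by
  induction h with
  | nil => exact .nil
  | left _ ih => exact .left ih
  | right _ ih => rw [List.append_assoc]; exact .left (.right ih)

theorem eq_nil_or_exists_of_append_right {w : List β} (h : InMonoid a (a ++ b) w) :
    w = [] ∨ ∃ x, InMonoid a b x ∧ w = a ++ x := by
  cases h with
  | nil => exact .inl rfl
  | left h => exact .inr ⟨_, h.of_append_right, rfl⟩
  | right h => exact .inr ⟨_, .right h.of_append_right, by rw [List.append_assoc]⟩

end InMonoid

/-- A common prefix of `p ++ x` and `p ++ y` exceeds `p` by at most a common prefix of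
`x` and `y`. -/
theorem length_lt_of_prefix_append {β : Type*} {p x y c : List β} {k : ℕ} (hk : 0 < k)
    (H : ∀ d, d <+: x → d <+: y → d.length < k) (hx : c <+: p ++ x) (hy : c <+: p ++ y) :
    c.length < p.length + k := by
  rcases Nat.lt_or_ge c.length p.length with h | h
  · omega
  obtain ⟨d, rfl⟩ := List.prefix_of_prefix_length_le (List.prefix_append p x) hx h
  have := H d ((List.prefix_append_right_inj p).1 hx) ((List.prefix_append_right_inj p).1 hy)
  simp only [List.length_append]
  omega

/-- If `a` and `b` do not commute, then a product of copies of `a` and `b` starting with `a` and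
one starting with `b` have only a short common prefix. -/
theorem length_prefix_lt_of_not_commute {β : Type*} {a b x y c : List β}
    (hab : a ++ b ≠ b ++ a) (hx : InMonoid a b x) (hy : InMonoid a b y)
    (hcx : c <+: a ++ x) (hcy : c <+: b ++ y) : c.length < a.length + b.length := by
  induction hn : a.length + b.length using Nat.strong_induction_on generalizing a b x y c with
  | _ n ih =>
  subst hn
  wlog hle : a.length ≤ b.length generalizing a b x y
  · have := this hab.symm hy.swap hx.swap hcy hcx
      (fun m hm a' b' x' y' c' h₁ h₂ h₃ h₄ h₅ h₆ => ih m (by omega) h₁ h₂ h₃ h₄ h₅ h₆) (by omega)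
    omega
  have ha : 0 < a.length := by
    rcases a with _ | _
    · simp at hab
    · simp
  rcases Nat.lt_or_ge c.length a.length with h | h
  · omega
  have hac : a <+: c := List.prefix_of_prefix_length_le (List.prefix_append a x) hcx h
  obtain ⟨b', rfl⟩ := List.prefix_of_prefix_length_le (hac.trans hcy) (List.prefix_append b y) hle
  have hab' : a ++ b' ≠ b' ++ a := fun h => hab (by rw [List.append_assoc, ← h])
  have hb' : 0 < b'.length := by
    rcases b' with _ | _
    · simp at hab'
    · simp
  rcases hx.eq_nil_or_exists_of_append_right with rfl | ⟨x', hx', rfl⟩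
  · have := hcx.length_le
    simp only [List.length_append, List.length_nil] at *
    omega
  · rw [List.append_assoc] at hcy
    have := length_lt_of_prefix_append (k := a.length + b'.length) (by omega)
      (fun d h₁ h₂ => ih _ (by simp only [List.length_append]; omega) hab' hx'
        hy.of_append_right h₁ h₂ rfl) hcx hcy
    simp only [List.length_append]
    omega

section Words

variable {α : Type*}

@[simp]
theorem listPow_length (w : Word α) (n : ℕ) : (listPow w n).length = n * w.length := by
  simp [listPow]

theorem listPow_succ (w : Word α) (n : ℕ) : listPow w (n + 1) = w ++ listPow w n := by
  simp [listPow, List.replicate_succ]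

theorem listPow_add (w : Word α) (m n : ℕ) : listPow w (m + n) = listPow w m ++ listPow w n := by
  rw [listPow, List.replicate_add, List.flatten_append, listPow, listPow]

theorem InMonoid.listPow (a b : Word α) (n : ℕ) : InMonoid a b (listPow a n) := by
  induction n with
  | zero => exact .nil
  | succ n ih => rw [listPow_succ]; exact .left ih

@[simp]
theorem wordInv_length (w : Word α) : (wordInv w).length = w.length := by
  simp [wordInv]

theorem wordInv_append (x y : Word α) : wordInv (x ++ y) = wordInv y ++ wordInv x := by
  simp [wordInv]

@[simp]
theorem wordInv_wordInv (x : Word α) : wordInv (wordInv x) = x := by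
  simp [wordInv, Function.comp_def]

theorem wordInv_listPow (w : Word α) (n : ℕ) :
    wordInv (listPow w n) = listPow (wordInv w) n := by
  induction n with
  | zero => rfl
  | succ n ih =>
    rw [listPow_succ, wordInv_append, ih, listPow_add]
    simp [listPow]

theorem InMonoid.wordInv {a b w : Word α} (h : InMonoid a b w) :
    InMonoid (wordInv a) (wordInv b) (wordInv w) := by
  induction h with
  | nil => exact .nil
  | left _ ih => rw [wordInv_append]; exact ih.append .left_self
  | right _ ih => rw [wordInv_append]; exact ih.append .right_self

theorem CyclicallyReduced.ne_wordInv {w : Word α} (hw : CyclicallyReduced w) (hne : w ≠ []) :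
    w ≠ wordInv w := by
  intro h
  have hj := (List.isChain_append.1 hw).2.2 (w.getLast hne) (List.getLast?_eq_some_getLast hne ▸ rfl)
    (w.head hne) (List.head?_eq_some_head hne ▸ rfl)
  have hl : w.head? = w.getLast?.map fun l => (l.1, !l.2) := by
    conv_lhs => rw [h]
    simp [wordInv]
  rw [List.head?_eq_some_head hne, List.getLast?_eq_some_getLast hne] at hl
  simp only [Option.map_some, Option.some.injEq] at hl
  exact hj (by simp [hl])

/-- The word `b a^γ b a^(γ+1) ⋯ b a^(γ+n-1) b`. -/
def ladder (a b : Word α) (γ n : ℕ) : Word α :=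
  b ++ ((List.range n).map fun j => listPow a (γ + j) ++ b).flatten

theorem ladder_succ (a b : Word α) (γ n : ℕ) :
    ladder a b γ (n + 1) = ladder a b γ n ++ (listPow a (γ + n) ++ b) := by
  simp [ladder, List.range_succ]

theorem InMonoid.ladder (a b : Word α) (γ n : ℕ) : InMonoid a b (ladder a b γ n) := by
  induction n with
  | zero => simpa [_root_.ladder] using right_self
  | succ n ih => rw [ladder_succ]; exact ih.append ((InMonoid.listPow a b _).append .right_self)

theorem exists_ladder_eq (a b : Word α) (γ n : ℕ) :
    ∃ x, InMonoid a b x ∧ ladder a b γ (n + 1) = b ++ (listPow a γ ++ (b ++ x)) := by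
  induction n with
  | zero => exact ⟨[], .nil, by simp [ladder]⟩
  | succ n ih =>
    obtain ⟨x, hx, h⟩ := ih
    refine ⟨_, hx.append ((InMonoid.listPow a b (γ + (n + 1))).append .right_self), ?_⟩
    rw [ladder_succ, h]
    simp only [List.append_assoc]

theorem exists_wordInv_ladder_eq (a b : Word α) (γ n : ℕ) :
    ∃ x, InMonoid (wordInv a) (wordInv b) x ∧ wordInv (ladder a b γ (n + 2)) =
      wordInv b ++ (listPow (wordInv a) (γ + n + 1) ++ (wordInv b ++ x)) := by
  refine ⟨_, ((InMonoid.ladder a b γ n).append (InMonoid.listPow a b (γ + n))).wordInv, ?_⟩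
  simp only [ladder_succ, wordInv_append, wordInv_listPow, List.append_assoc, Nat.add_assoc]

theorem two_mul_ladder_length (a b : Word α) (γ n : ℕ) :
    2 * (ladder a b γ (n + 1)).length =
      2 * (n + 2) * b.length + (n + 1) * (2 * γ + n) * a.length := by
  induction n with
  | zero => simp [ladder]; ring
  | succ n ih =>
    rw [ladder_succ, List.length_append, Nat.mul_add, ih]
    simp only [List.length_append, listPow_length]
    ring

theorem lt_ladder_length {a b : Word α} (hb : b ≠ []) {γ δ : ℕ} (hγ : 90 ≤ γ)
    (hδ : γ + 90 ≤ δ) :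
    30 * (2 * b.length + (δ + 1) * a.length) < (ladder a b γ (δ + 1 - γ)).length := by
  obtain ⟨n, rfl⟩ := Nat.exists_eq_add_of_le (show γ ≤ δ by omega)
  have hlen := two_mul_ladder_length a b γ n
  rw [show γ + n + 1 - γ = n + 1 by omega]
  have hb' : 0 < b.length := List.length_pos_iff.2 hb
  have h₁ : 184 * b.length ≤ 2 * (n + 2) * b.length := Nat.mul_le_mul_right _ (by omega)
  have h₂ : 60 * (γ + n + 1) * a.length ≤ (n + 1) * (2 * γ + n) * a.length :=
    Nat.mul_le_mul_right _ (by nlinarith)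
  linarith

/-- Common prefixes of two products of copies of `a` and `b` that start with `b a^p b` and
`b a^q b`, where `p < q`. -/
theorem length_prefix_lt_of_lt {a b x y c : Word α} (hab : a ++ b ≠ b ++ a) {p q : ℕ}
    (hpq : p < q) (hx : InMonoid a b x) (hy : InMonoid a b y)
    (hcx : c <+: b ++ (listPow a p ++ (b ++ x))) (hcy : c <+: b ++ (listPow a q ++ (b ++ y))) :
    c.length < 2 * b.length + (p + 1) * a.length := by
  obtain ⟨k, rfl⟩ := Nat.exists_eq_add_of_lt hpq
  rw [Nat.add_assoc, listPow_add, listPow_succ, List.append_assoc, List.append_assoc,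
    ← List.append_assoc] at hcy
  rw [← List.append_assoc] at hcx
  have hpos : 0 < a.length + b.length := by
    rcases a with _ | _
    · simp at hab
    · simp only [List.length_cons]; omega
  have := length_lt_of_prefix_append hpos (fun d h₁ h₂ => length_prefix_lt_of_not_commute hab
    ((InMonoid.listPow a b k).append (.right hy)) hx h₂ h₁) hcx hcy
  simp only [List.length_append, listPow_length] at this
  linarith

theorem length_prefix_ladder_lt {a b c : Word α} (hab : a ++ b ≠ b ++ a) {γ δ γ' δ' : ℕ}
    (hδ : γ ≤ δ) (hδ' : γ' ≤ δ') (h : δ < γ') (hc : c <+: ladder a b γ (δ + 1 - γ))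
    (hc' : c <+: ladder a b γ' (δ' + 1 - γ')) :
    c.length < 2 * b.length + (δ + 1) * a.length := by
  obtain ⟨x, hx, ex⟩ := exists_ladder_eq a b γ (δ - γ)
  obtain ⟨y, hy, ey⟩ := exists_ladder_eq a b γ' (δ' - γ')
  rw [Nat.sub_add_comm hδ, ex] at hc
  rw [Nat.sub_add_comm hδ', ey] at hc'
  have := length_prefix_lt_of_lt hab (by omega) hx hy hc hc'
  have : (γ + 1) * a.length ≤ (δ + 1) * a.length := Nat.mul_le_mul_right _ (by omega)
  omega

theorem length_prefix_wordInv_ladder_lt {a b c : Word α} (hab : a ++ b ≠ b ++ a)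
    {γ δ γ' δ' : ℕ} (hδ : γ < δ) (hδ' : γ' < δ') (h : δ < γ')
    (hc : c <+: wordInv (ladder a b γ (δ + 1 - γ)))
    (hc' : c <+: wordInv (ladder a b γ' (δ' + 1 - γ'))) :
    c.length < 2 * b.length + (δ + 1) * a.length := by
  have hab' : wordInv a ++ wordInv b ≠ wordInv b ++ wordInv a := by
    intro h
    rw [← wordInv_append, ← wordInv_append] at h
    exact hab (by simpa using (congrArg wordInv h).symm)
  obtain ⟨n, rfl⟩ := Nat.exists_eq_add_of_lt hδ
  obtain ⟨m, rfl⟩ := Nat.exists_eq_add_of_lt hδ'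
  obtain ⟨x, hx, ex⟩ := exists_wordInv_ladder_eq a b γ n
  obtain ⟨y, hy, ey⟩ := exists_wordInv_ladder_eq a b γ' m
  rw [show γ + n + 1 + 1 - γ = n + 2 by omega, ex] at hc
  rw [show γ' + m + 1 + 1 - γ' = m + 2 by omega, ey] at hc'
  simpa using length_prefix_lt_of_lt hab' (by omega) hx hy hc hc'

theorem length_prefix_ladder_wordInv_ladder_lt {a b c : Word α} (hb : b ≠ wordInv b)
    {γ n γ' m : ℕ} (hc : c <+: ladder a b γ n)
    (hc' : c <+: wordInv (ladder a b γ' (m + 2))) : c.length < b.length := by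
  by_contra! h
  obtain ⟨y, -, ey⟩ := exists_wordInv_ladder_eq a b γ' m
  rw [ey] at hc'
  have h₁ : b <+: c := List.prefix_of_prefix_length_le (List.prefix_append _ _) hc h
  have h₂ : wordInv b <+: c :=
    List.prefix_of_prefix_length_le (List.prefix_append _ _) hc' (by simpa using h)
  exact hb ((List.prefix_of_prefix_length_le h₁ h₂ (by simp)).eq_of_length (by simp))

theorem append_ne_append_of_no_common_suffix {a b : Word α} (ha : a ≠ []) (hb : b ≠ [])
    (h : ¬ ∃ s : Word α, s ≠ [] ∧ s <:+ a ∧ s <:+ b) : a ++ b ≠ b ++ a := by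
  intro e
  have h₁ : a <:+ b ++ a := List.suffix_append b a
  have h₂ : b <:+ b ++ a := e ▸ List.suffix_append a b
  rcases List.suffix_or_suffix_of_suffix h₁ h₂ with h' | h'
  · exact h ⟨a, ha, List.suffix_rfl, h'⟩
  · exact h ⟨b, hb, h', List.suffix_rfl⟩

end Words

/-- Let `w₁, w₂` be non-empty cyclically reduced words such that `w₁·w₂` and
`w₂·w₁` have no cancellations, `w₁` and `w₂` have no common non-empty suffix, and `w₁` is not
a proper power. For `i = 1, 2, 3` put `vᵢ = w₂ w₁^{γᵢ} w₂ w₁^{γᵢ+1} ⋯ w₂ w₁^{δᵢ} w₂` where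
`γ₁ ≥ 90`, `δᵢ ≥ γᵢ + 90` and `γ_{i+1} ≥ δᵢ + 90`. Then for any two distinct words
`A₁, A₂ ∈ {v₁^{±1}, v₂^{±1}, v₃^{±1}}` their (longest) common prefix `c` satisfies
`|c| < |A₁|/30` and `|c| < |A₂|/30`. -/
theorem common_prefix_small {α : Type*} (w1 w2 : Word α)
    (h1 : w1 ≠ []) (h2 : w2 ≠ [])
    (hc1 : CyclicallyReduced w1) (hc2 : CyclicallyReduced w2)
    (h12 : Reduced (w1 ++ w2)) (h21 : Reduced (w2 ++ w1))
    (hsuf : ¬ ∃ s : Word α, s ≠ [] ∧ s <:+ w1 ∧ s <:+ w2)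
    (hpow : ¬ ∃ (p : Word α) (n : ℕ), 2 ≤ n ∧ w1 = listPow p n)
    (γ δ : Fin 3 → ℕ)
    (hγ0 : 90 ≤ γ 0) (hδ : ∀ i, γ i + 90 ≤ δ i)
    (hstep : ∀ i : Fin 2, δ i.castSucc + 90 ≤ γ i.succ)
    (v : Fin 3 → Word α)
    (hv : ∀ i, v i =
      w2 ++ ((List.range (δ i + 1 - γ i)).map fun j => listPow w1 (γ i + j) ++ w2).flatten) :
    ∀ A1 ∈ ({v 0, wordInv (v 0), v 1, wordInv (v 1), v 2, wordInv (v 2)} : Set (Word α)),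
    ∀ A2 ∈ ({v 0, wordInv (v 0), v 1, wordInv (v 1), v 2, wordInv (v 2)} : Set (Word α)),
      A1 ≠ A2 → ∀ c : Word α, c <+: A1 → c <+: A2 →
        30 * c.length < A1.length ∧ 30 * c.length < A2.length := by
  have hab := append_ne_append_of_no_common_suffix h1 h2 hsuf
  have hinv := hc2.ne_wordInv h2
  have hv' : ∀ i, v i = ladder w1 w2 (γ i) (δ i + 1 - γ i) := hv
  have hlt : ∀ i j, i < j → δ i < γ j := by
    have h₀ := hstep 0
    have h₁ := hstep 1
    have h₂ := hδ 1
    simp only [Fin.castSucc_zero, Fin.succ_zero_eq_one, Fin.castSucc_one, Fin.succ_one_eq_two]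
      at h₀ h₁
    intro i j hij
    fin_cases i <;> fin_cases j <;> simp at hij ⊢ <;> omega
  have hγ : ∀ i, 90 ≤ γ i := by
    intro i
    rcases eq_or_ne i 0 with rfl | hi
    · exact hγ0
    · have := hlt 0 i (Fin.pos_of_ne_zero hi)
      have := hδ 0
      omega
  have hbound : ∀ i j, i ≤ j →
      30 * (2 * w2.length + (δ i + 1) * w1.length) < (v j).length := by
    intro i j hij
    refine lt_of_le_of_lt ?_ (hv' j ▸ lt_ladder_length h2 (hγ j) (hδ j))
    have : δ i ≤ δ j := by
      rcases hij.eq_or_lt with rfl | h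
      · rfl
      · have := hlt i j h
        have := hδ j
        omega
    gcongr
  have hpos : ∀ i j, i < j → ∀ c, c <+: v i → c <+: v j →
      30 * c.length < (v i).length ∧ 30 * c.length < (v j).length := by
    intro i j hij c hi hj
    have hi' := hδ i
    have hj' := hδ j
    have := length_prefix_ladder_lt hab (by omega) (by omega) (hlt i j hij)
      (hv' i ▸ hi) (hv' j ▸ hj)
    have := hbound i i le_rfl
    have := hbound i j hij.le
    constructor <;> omega
  have hneg : ∀ i j, i < j → ∀ c, c <+: wordInv (v i) → c <+: wordInv (v j) →
      30 * c.length < (v i).length ∧ 30 * c.length < (v j).length := by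
    intro i j hij c hi hj
    have hi' := hδ i
    have hj' := hδ j
    have := length_prefix_wordInv_ladder_lt hab (by omega) (by omega) (hlt i j hij)
      (hv' i ▸ hi) (hv' j ▸ hj)
    have := hbound i i le_rfl
    have := hbound i j hij.le
    constructor <;> omega
  have hmix : ∀ i j, ∀ c, c <+: v i → c <+: wordInv (v j) →
      30 * c.length < (v i).length ∧ 30 * c.length < (v j).length := by
    intro i j c hi hj
    have hj' := hδ j
    rw [hv' i] at hi
    rw [hv' j, show δ j + 1 - γ j = (δ j - 1 - γ j) + 2 by omega] at hj
    have := length_prefix_ladder_wordInv_ladder_lt hinv hi hj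
    have := hbound i i le_rfl
    have := hbound j j le_rfl
    constructor <;> linarith [Nat.zero_le ((δ i + 1) * w1.length),
      Nat.zero_le ((δ j + 1) * w1.length)]
  have hmem : ∀ A ∈ ({v 0, wordInv (v 0), v 1, wordInv (v 1), v 2, wordInv (v 2)} :
      Set (Word α)), ∃ i, A = v i ∨ A = wordInv (v i) := by
    rintro A (h | h | h | h | h | h)
    exacts [⟨0, .inl h⟩, ⟨0, .inr h⟩, ⟨1, .inl h⟩, ⟨1, .inr h⟩, ⟨2, .inl h⟩, ⟨2, .inr h⟩]
  intro A1 hA1 A2 hA2 hne c hc1 hc2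
  obtain ⟨i, rfl | rfl⟩ := hmem A1 hA1 <;> obtain ⟨j, rfl | rfl⟩ := hmem A2 hA2 <;>
    try simp only [wordInv_length]
  · rcases lt_or_gt_of_ne (fun h : i = j => hne (by rw [h])) with h | h
    · exact hpos i j h c hc1 hc2
    · exact (hpos j i h c hc2 hc1).symm
  · exact hmix i j c hc1 hc2
  · exact (hmix j i c hc2 hc1).symm
  · rcases lt_or_gt_of_ne (fun h : i = j => hne (by rw [h])) with h | h
    · exact hneg i j h c hc1 hc2
    · exact (hneg j i h c hc2 hc1).symm
end

section
/- Let k be a field. There exists an algebra R over k that is amenable in the sense of Bartholdi and contains a subalgebra isomorphic to the free associative algebra k⟨x, y⟩ on two free generators; in particular, an amenable algebra can contain a free subalgebra of rank two. Such an R can be taken to be the group algebra kG of a solvable group G containing a free subsemigroup on two generators. -/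
open scoped Pointwise

/-- The lamplighter group `ℤ/2 ≀ ℤ`, with lamp configurations encoded as Laurent polynomials
over `ZMod 2`. -/
@[ext]
structure Lamplighter : Type where
  /-- The lamp configuration. -/
  lamps : LaurentPolynomial (ZMod 2)
  /-- The position of the lamplighter. -/
  pos : ℤ

namespace Lamplighter

open LaurentPolynomial

noncomputable instance : Mul Lamplighter := ⟨fun g h => ⟨T h.pos * g.lamps + h.lamps, g.pos + h.pos⟩⟩

noncomputable instance : One Lamplighter := ⟨⟨0, 0⟩⟩

noncomputable instance : Inv Lamplighter := ⟨fun g => ⟨-(T (-g.pos) * g.lamps), -g.pos⟩⟩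

@[simp] lemma mul_lamps (g h : Lamplighter) :
    (g * h).lamps = T h.pos * g.lamps + h.lamps := rfl

@[simp] lemma mul_pos (g h : Lamplighter) : (g * h).pos = g.pos + h.pos := rfl

@[simp] lemma one_lamps : (1 : Lamplighter).lamps = 0 := rfl

@[simp] lemma one_pos : (1 : Lamplighter).pos = 0 := rfl

@[simp] lemma inv_lamps (g : Lamplighter) : (g⁻¹).lamps = -(T (-g.pos) * g.lamps) := rfl

@[simp] lemma inv_pos (g : Lamplighter) : (g⁻¹).pos = -g.pos := rfl

noncomputable instance : Group Lamplighter :=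
  Group.ofLeftAxioms
    (fun a b c => by 
      ext1
      · simp only [mul_lamps, mul_pos, T_add]
        ring
      · exact add_assoc _ _ _)
    (fun a => by ext1 <;> simp)
    (fun a => by
      ext1
      · simp only [mul_lamps, inv_lamps, one_lamps, mul_neg, ← mul_assoc, ← T_add]
        simp
      · simp)

/-- The position of the lamplighter, as a homomorphism to `ℤ`. -/
def posHom : Lamplighter →* Multiplicative ℤ where
  toFun g := Multiplicative.ofAdd g.pos
  map_one' := rfl
  map_mul' _ _ := rfl

/-- The inclusion of the group of lamp configurations. -/
def lampsHom : Multiplicative (LaurentPolynomial (ZMod 2)) →* Lamplighter where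
  toFun p := ⟨p.toAdd, 0⟩
  map_one' := rfl
  map_mul' p q := by ext1 <;> simp

theorem isSolvable : Group.IsSolvable Lamplighter := by
  refine Group.isSolvable_of_ker_le_range lampsHom posHom fun g hg => ?_
  have h : g.pos = 0 := hg
  exact ⟨Multiplicative.ofAdd g.lamps, by ext1 <;> simp [lampsHom, h]⟩

/-- The homomorphism from the free monoid sending the letter `i` to the lamp configuration `i`
followed by a unit step. -/
noncomputable def freeHom : FreeMonoid (Fin 2) →* Lamplighter :=
  FreeMonoid.lift fun i => ⟨C ((i : ℕ) : ZMod 2), 1⟩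

/-- The polynomial over `ZMod 2` whose coefficients are the letters of a word. -/
noncomputable def wordPoly (w : List (Fin 2)) : Polynomial (ZMod 2) :=
  w.foldl (fun p i => Polynomial.X * p + Polynomial.C ((i : ℕ) : ZMod 2)) 0

lemma wordPoly_append_singleton (w : List (Fin 2)) (i : Fin 2) :
    wordPoly (w ++ [i]) = Polynomial.X * wordPoly w + Polynomial.C ((i : ℕ) : ZMod 2) := by
  simp [wordPoly]

lemma natCast_injective : Function.Injective fun i : Fin 2 => ((i : ℕ) : ZMod 2) := by
  decide

lemma wordPoly_injective_of_length_eq (v : List (Fin 2)) :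
    ∀ w : List (Fin 2), v.length = w.length → wordPoly v = wordPoly w → v = w := by
  induction v using List.reverseRecOn with
  | nil => intro w hl _; exact (List.length_eq_zero_iff.1 hl.symm).symm
  | append_singleton v i ih =>
    intro w hl hw
    obtain rfl | ⟨w, j, rfl⟩ := w.eq_nil_or_concat'
    · simp at hl
    · rw [wordPoly_append_singleton, wordPoly_append_singleton] at hw
      have h0 : i = j := by
        have := congrArg (Polynomial.coeff · 0) hw
        exact natCast_injective (by simpa using this)
      subst h0
      rw [ih w (by simpa using hl) (mul_left_cancel₀ Polynomial.X_ne_zero (add_right_cancel hw))]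

lemma freeHom_ofList (w : List (Fin 2)) :
    freeHom (FreeMonoid.ofList w) = ⟨Polynomial.toLaurent (wordPoly w), w.length⟩ := by
  induction w using List.reverseRecOn with
  | nil => ext1 <;> simp [wordPoly]
  | append_singleton w i ih =>
    rw [FreeMonoid.ofList_append, map_mul, ih, wordPoly_append_singleton]
    ext1 <;> simp [freeHom, Polynomial.toLaurent_X]

lemma freeHom_injective : Function.Injective freeHom := by
  intro v w h
  have h' : freeHom (FreeMonoid.ofList v.toList) = freeHom (FreeMonoid.ofList w.toList) := h
  rw [freeHom_ofList, freeHom_ofList, Lamplighter.mk.injEq] at h'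
  exact FreeMonoid.toList.injective <| wordPoly_injective_of_length_eq _ _
    (by exact_mod_cast h'.2) (Polynomial.toLaurent_injective h'.1)

/-- The elements with lamp configuration in `V` and position in `I`. -/
def box (V : Finset (LaurentPolynomial (ZMod 2))) (I : Finset ℤ) : Finset Lamplighter :=
  (V ×ˢ I).map ⟨fun x => ⟨x.1, x.2⟩, fun x y h => by
    simpa [Prod.ext_iff] using h⟩

lemma mem_box {V : Finset (LaurentPolynomial (ZMod 2))} {I : Finset ℤ} {g : Lamplighter} :
    g ∈ box V I ↔ g.lamps ∈ V ∧ g.pos ∈ I := by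
  constructor
  · intro h
    obtain ⟨x, hx, rfl⟩ := Finset.mem_map.1 h
    exact Finset.mem_product.1 hx
  · exact fun h => Finset.mem_map.2 ⟨(g.lamps, g.pos), Finset.mem_product.2 h, rfl⟩

lemma card_box (V : Finset (LaurentPolynomial (ZMod 2))) (I : Finset ℤ) :
    (box V I).card = V.card * I.card := by
  rw [box, Finset.card_map, Finset.card_product]

lemma exists_finset_add_mem (X : Set (LaurentPolynomial (ZMod 2))) (hX : X.Finite) :
    ∃ V : Finset (LaurentPolynomial (ZMod 2)), V.Nonempty ∧ ∀ x ∈ X, ∀ v ∈ V, x + v ∈ V := by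
  have := FiniteDimensional.span_of_finite (ZMod 2) hX
  have hfin : (Submodule.span (ZMod 2) X : Set (LaurentPolynomial (ZMod 2))).Finite :=
    have := Module.finite_of_finite (ZMod 2) (M := Submodule.span (ZMod 2) X)
    Set.toFinite _
  refine ⟨hfin.toFinset, ⟨0, by simp⟩, fun x hx v hv => ?_⟩
  rw [Set.Finite.mem_toFinset] at hv ⊢
  exact add_mem (Submodule.subset_span hx) hv

lemma exists_folner [DecidableEq Lamplighter] (ε : ℝ) (hε : 0 < ε) (K : Finset Lamplighter) :
    ∃ F : Finset Lamplighter, F.Nonempty ∧ (((K * F) \ F).card : ℝ) < ε * F.card := by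
  obtain ⟨A, hA⟩ : ∃ A : ℕ, ∀ g ∈ K, g.pos.natAbs ≤ A :=
    ⟨K.sup fun g => g.pos.natAbs, fun g hg => Finset.le_sup (f := fun g => g.pos.natAbs) hg⟩
  obtain ⟨n, hn⟩ := exists_nat_gt (2 * A / ε)
  have hn' : (2 * A : ℝ) < ε * n := by rwa [div_lt_iff₀' hε] at hn
  have hn0 : 0 < n := by
    have : (0 : ℝ) < n := lt_of_le_of_lt (by positivity) hn
    exact_mod_cast this
  obtain ⟨V, hV, hVK⟩ := exists_finset_add_mem
    ((fun x : ℤ × Lamplighter => T x.1 * x.2.lamps) '' (Finset.Ico (0 : ℤ) n ×ˢ K : Finset _))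
    ((Finset.finite_toSet _).image _)
  have hVpos : (0 : ℝ) < V.card := by exact_mod_cast hV.card_pos
  refine ⟨box V (Finset.Ico 0 n), ?_, ?_⟩
  · rw [← Finset.card_pos, card_box]
    simpa using ⟨hV, hn0⟩
  · have hsub : (K * box V (Finset.Ico 0 n)) \ box V (Finset.Ico 0 n) ⊆
        box V (Finset.Ico (-A : ℤ) 0 ∪ Finset.Ico (n : ℤ) (n + A)) := by
      intro x hx
      obtain ⟨hx, hxF⟩ := Finset.mem_sdiff.1 hx
      obtain ⟨g, hg, f, hf, rfl⟩ := Finset.mem_mul.1 hx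
      rw [mem_box] at hf hxF ⊢
      have hlamps : (g * f).lamps ∈ V := by
        refine hVK _ ⟨(f.pos, g), ?_, rfl⟩ _ hf.1
        exact Finset.mem_coe.2 (Finset.mem_product.2 ⟨hf.2, hg⟩)
      refine ⟨hlamps, ?_⟩
      have hgA := hA g hg
      have hpos : ¬ (g * f).pos ∈ Finset.Ico (0 : ℤ) n := fun h => hxF ⟨hlamps, h⟩
      have hf2 := hf.2
      simp only [Finset.mem_union, Finset.mem_Ico, mul_pos] at hpos hf2 ⊢
      omega
    have hcard : ((K * box V (Finset.Ico 0 n)) \ box V (Finset.Ico 0 n)).card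
        ≤ V.card * (2 * A) := by
      refine (Finset.card_le_card hsub).trans ?_
      rw [card_box]
      refine Nat.mul_le_mul_left _ ((Finset.card_union_le _ _).trans ?_)
      simp only [Int.card_Ico]
      omega
    calc (((K * box V (Finset.Ico 0 n)) \ box V (Finset.Ico 0 n)).card : ℝ)
        ≤ V.card * (2 * A) := by exact_mod_cast hcard
      _ < V.card * (ε * n) := by gcongr
      _ = ε * (box V (Finset.Ico 0 n)).card := by
        rw [card_box]; simp; ring

end Lamplighter

namespace MonoidAlgebra

variable {k G : Type*} [Field k]

/-- The elements of the monoid algebra supported on `s` are the finitely supported functions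
on `s`. -/
noncomputable def supportedEquiv (s : Set G) : supported k k s ≃ₗ[k] (s →₀ k) :=
  ((coeffLinearEquiv k).submoduleMap (supported k k s)).trans <|
    (LinearEquiv.ofEq _ (Finsupp.supported k k s)
      (Submodule.map_comap_eq_of_surjective (coeffLinearEquiv k).surjective _)).trans
      (Finsupp.supportedEquivFinsupp s)

instance finiteDimensional_supported (s : Finset G) :
    FiniteDimensional k (supported k k (s : Set G)) :=
  Module.Finite.equiv (supportedEquiv (s : Set G)).symm

lemma finrank_supported (s : Finset G) :
    Module.finrank k (supported k k (s : Set G)) = s.card := by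
  rw [(supportedEquiv (s : Set G)).finrank_eq, Module.finrank_finsupp_self]
  simp

lemma exists_support_subset (S : Submodule k (MonoidAlgebra k G)) [FiniteDimensional k S] :
    ∃ K : Finset G, ∀ x ∈ S, x.coeff.support ⊆ K := by
  classical
  obtain ⟨t, ht⟩ := (Submodule.fg_iff_finiteDimensional S).2 inferInstance
  refine ⟨t.biUnion fun x => x.coeff.support, fun x hx => ?_⟩
  have : S ≤ supported k k ((t.biUnion fun x => x.coeff.support : Finset G) : Set G) := by
    rw [← ht, Submodule.span_le]
    intro y hy
    exact mem_supported.2 <| Finset.coe_subset.2 <|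
      Finset.subset_biUnion_of_mem (fun x : MonoidAlgebra k G => x.coeff.support) hy
  exact Finset.coe_subset.1 (mem_supported.1 (this hx))

/-- The group algebra of a group satisfying the Følner condition is amenable. -/
theorem isAmenableAlg_of_folner [Group G] [DecidableEq G]
    (h : ∀ ε : ℝ, 0 < ε → ∀ K : Finset G,
      ∃ F : Finset G, F.Nonempty ∧ (((K * F) \ F).card : ℝ) < ε * F.card) :
    IsAmenableAlg k (MonoidAlgebra k G) := by
  intro ε hε S hS
  obtain ⟨K, hK⟩ := exists_support_subset S
  obtain ⟨F, hF, hKF⟩ := h ε hε K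
  have hrank := finrank_supported (k := k) F
  refine ⟨supported k k (F : Set G), inferInstance, ?_, fun s hs => ?_⟩
  · intro h0
    rw [h0, finrank_bot] at hrank
    exact hF.card_pos.ne hrank
  · rw [hrank]
    refine lt_of_le_of_lt ?_ hKF
    have hle : supported k k (F : Set G) ⊔
        (supported k k (F : Set G)).map (LinearMap.mulLeft k s) ≤
        supported k k ((F ∪ K * F : Finset G) : Set G) := by
      refine sup_le (fun x hx => ?_) (Submodule.map_le_iff_le_comap.2 fun x hx => ?_)
      · exact mem_supported.2 ((mem_supported.1 hx).trans (by simp))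
      · have hx' : x.coeff.support ⊆ F := Finset.coe_subset.1 (mem_supported.1 hx)
        exact mem_supported.2 <| Finset.coe_subset.2 <|
          (support_coeff_mul_subset s x).trans <|
            (Finset.mul_subset_mul (hK s hs) hx').trans Finset.subset_union_right
    have hfin := Submodule.finiteDimensional_of_le hle
    have h1 := Submodule.finrank_mono hle
    have h2 := Submodule.finrank_quotient_add_finrank
      ((supported k k (F : Set G)).comap (supported k k (F : Set G) ⊔
        (supported k k (F : Set G)).map (LinearMap.mulLeft k s)).subtype)
    rw [(Submodule.comapSubtypeEquivOfLe le_sup_left).finrank_eq, hrank] at h2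
    rw [finrank_supported] at h1
    have h3 : (F ∪ K * F).card = F.card + ((K * F) \ F).card := by
      rw [← Finset.union_sdiff_self_eq_union, Finset.card_union_of_disjoint Finset.disjoint_sdiff]
    unfold sMulQuotDim
    exact_mod_cast (by omega)

end MonoidAlgebra

/-- There exists an algebra `R` over `k` that is amenable in the sense of
Bartholdi and contains a subalgebra isomorphic to the free associative algebra `k⟨x, y⟩`;
such an `R` can be taken to be the group algebra `kG` of a solvable group `G` containing a
free subsemigroup on two generators. -/
theorem amenable_algebra_with_free_subalgebra (k : Type*) [Field k] :
    ∃ (G : Type) (_ : Group G), IsSolvable G ∧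
      (∃ f : FreeMonoid (Fin 2) →* G, Function.Injective f) ∧
      IsAmenableAlg k (MonoidAlgebra k G) ∧
      ∃ φ : FreeAlgebra k (Fin 2) →ₐ[k] MonoidAlgebra k G, Function.Injective φ := by
  classical
  refine ⟨Lamplighter, inferInstance, Lamplighter.isSolvable,
    ⟨Lamplighter.freeHom, Lamplighter.freeHom_injective⟩,
    MonoidAlgebra.isAmenableAlg_of_folner Lamplighter.exists_folner,
    (MonoidAlgebra.mapDomainAlgHom k k Lamplighter.freeHom).comp
      FreeAlgebra.equivMonoidAlgebraFreeMonoid.toAlgHom, ?_⟩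
  exact (MonoidAlgebra.mapDomain_injective Lamplighter.freeHom_injective).comp
    FreeAlgebra.equivMonoidAlgebraFreeMonoid.injective
end
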